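/- For every n ≥ 3 there exists an n-dimensional compact connected topological (C⁰) manifold with boundary Y ⊆ ℝⁿ with nonempty boundary ∂Y such that Y satisfies condition (i) (ρ_Y(x,y) < ∞ for all x,y ∈ Y), but the function ρ_Y is not a metric on Y: there exist points A, O, D ∈ Y with ρ_Y(A,D) > ρ_Y(A,O) + ρ_Y(O,D). -/

import Mathlib

open Set Metric Filter

noncomputable section

/-- Euclidean `n`-space. -/
abbrev Euc (n : ℕ) := EuclideanSpace ℝ (Fin n)

/-- A domain: a nonempty open connected subset of Euclidean space. -/
def IsEucDomain {n : ℕ} (U : Set (Euc n)) : Prop := IsOpen U ∧ IsConnected U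

/-- Intrinsic extended distance inside `S`: the infimum of the lengths (total
variations) of continuous paths joining `x` and `y` within `S`. -/
def intrinsicDist {n : ℕ} (S : Set (Euc n)) (x y : Euc n) : ENNReal :=
  ⨅ (γ : ℝ → Euc n) (_ : ContinuousOn γ (Icc (0:ℝ) 1)) (_ : γ 0 = x) (_ : γ 1 = y)
    (_ : MapsTo γ (Icc (0:ℝ) 1) S), eVariationOn γ (Icc (0:ℝ) 1)

/-- The closed half-space `{v : x₀(v) ≥ 0}` in Euclidean `n`-space. -/
def closedHalfSpace (n : ℕ) (hn : 0 < n) : Set (Euc n) := {v | 0 ≤ v ⟨0, hn⟩}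

/-- The manifold interior of `Y ⊆ ℝⁿ`: points having a neighborhood in `Y`
homeomorphic to an open subset of `ℝⁿ`. -/
def mInterior (n : ℕ) (Y : Set (Euc n)) : Set (Euc n) :=
  {x | x ∈ Y ∧ ∃ N : Set (Euc n), N ∈ nhdsWithin x Y ∧ N ⊆ Y ∧
    ∃ O : Set (Euc n), IsOpen O ∧ Nonempty (↥N ≃ₜ ↥O)}

/-- `Y ⊆ ℝⁿ` is a topological (`C⁰`) `n`-manifold with boundary: every point has
a neighborhood in `Y` homeomorphic to an open subset of the closed half-space. -/
def IsC0ManifoldWithBoundary (n : ℕ) (hn : 0 < n) (Y : Set (Euc n)) : Prop :=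
  ∀ x ∈ Y, ∃ N : Set (Euc n), N ∈ nhdsWithin x Y ∧ N ⊆ Y ∧
    ∃ O : Set (Euc n), (∃ O' : Set (Euc n), IsOpen O' ∧ O = O' ∩ closedHalfSpace n hn) ∧
      Nonempty (↥N ≃ₜ ↥O)

/-- `ρ_Y(x,y)`: the liminf, over `x' → x`, `y' → y` with `x', y'` in the manifold
interior of `Y`, of the infimum of lengths of paths joining `x'` and `y'` within
the manifold interior of `Y`. -/
def rhoY (n : ℕ) (Y : Set (Euc n)) (x y : Euc n) : ENNReal :=
  liminf (fun p : Euc n × Euc n => intrinsicDist (mInterior n Y) p.1 p.2)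
    ((nhdsWithin x (mInterior n Y)) ×ˢ (nhdsWithin y (mInterior n Y)))

/-- Interpolation of `t ↦ det (1 + t A)` at `finrank + 1` nodes. -/
theorem det_one_add_eq_sum_lagrange {n : ℕ} (v : Fin (n + 1) → ℝ) (hv : Function.Injective v)
    (A : Euc n →L[ℝ] Euc n) :
    (1 + A).det =
      ∑ i, (Lagrange.basis Finset.univ v i).eval 1 * (1 + v i • A).det := by
  classical
  let b := (EuclideanSpace.basisFun (Fin n) ℝ).toBasis
  let M := LinearMap.toMatrix b b (A : Euc n →ₗ[ℝ] Euc n)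
  let P : Polynomial ℝ := Matrix.det
    ((Polynomial.X : Polynomial ℝ) • M.map Polynomial.C + (1 : Matrix _ _ ℝ).map Polynomial.C)
  have hP : ∀ t : ℝ, P.eval t = (1 + t • A).det := by
    intro t
    have h1 : (1 + t • A).det = Matrix.det (1 + t • M) := by
      rw [ContinuousLinearMap.det, ← LinearMap.det_toMatrix b]
      congr 1
      simp only [ContinuousLinearMap.toLinearMap_add, ContinuousLinearMap.toLinearMap_smul, map_add,
        map_smul, M]
      congr 1
      exact LinearMap.toMatrix_one b
    rw [h1]
    simp only [P]
    rw [← Polynomial.coe_evalRingHom, RingHom.map_det]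
    congr 1
    ext i j
    simp [Matrix.one_apply, apply_ite (Polynomial.eval t), add_comm]
    ring
  have hdeg : P.degree < (Finset.univ : Finset (Fin (n + 1))).card := by
    refine lt_of_le_of_lt Polynomial.degree_le_natDegree ?_
    have := Polynomial.natDegree_det_X_add_C_le M (1 : Matrix (Fin n) (Fin n) ℝ)
    simp only [Finset.card_univ, Fintype.card_fin] at this ⊢
    exact_mod_cast Nat.lt_succ_of_le this
  have h := Lagrange.eq_interpolate (s := Finset.univ) (v := v) hv.injOn hdeg
  have h1 := hP 1
  rw [one_smul] at h1
  rw [← h1, h, Lagrange.interpolate_apply, Polynomial.eval_finsetSum]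
  refine Finset.sum_congr rfl fun i _ => ?_
  rw [Polynomial.eval_mul, Polynomial.eval_C, hP, mul_comm]

open MeasureTheory in
/-- A `C¹` perturbation of the identity that maps a ball bijectively to itself for all small
times has, on average, Jacobian determinant one at time one. -/
theorem integral_det_one_add_eq_volume {n : ℕ} {h : Euc n → Euc n} (hh : ContDiff ℝ 1 h)
    (r δ : ℝ) (hδ : 0 < δ)
    (hsmall : ∀ t, 0 < t → t < δ → InjOn (fun x => x + t • h x) (ball 0 r) ∧
      (fun x => x + t • h x) '' ball 0 r = ball 0 r) :
    ∫ x in ball (0 : Euc n) r, (1 + fderiv ℝ h x).det = volume.real (ball (0 : Euc n) r) := by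
  have hcont : Continuous (fderiv ℝ h) := hh.continuous_fderiv one_ne_zero
  obtain ⟨C, hC⟩ := (isCompact_closedBall (0 : Euc n) r).exists_bound_of_continuousOn
    hcont.continuousOn
  have hdet : Continuous fun A : Euc n →L[ℝ] Euc n => A.det := ContinuousLinearMap.continuous_det
  obtain ⟨η, hη, hηpos⟩ : ∃ η > 0, ∀ A : Euc n →L[ℝ] Euc n, ‖A‖ < η → 0 < (1 + A).det := by
    have h1 : ∀ᶠ A in nhds (0 : Euc n →L[ℝ] Euc n), 0 < (1 + A).det := by
      have : Continuous fun A : Euc n →L[ℝ] Euc n => (1 + A).det :=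
        hdet.comp (continuous_const.add continuous_id)
      refine this.continuousAt.eventually_const_lt ?_
      change 0 < ((1 : Euc n →L[ℝ] Euc n) + 0).det
      have h2 : ((1 : Euc n →L[ℝ] Euc n) + 0).det = 1 := by
        rw [add_zero, ContinuousLinearMap.det]
        exact LinearMap.det_id
      rw [h2]
      exact one_pos
    obtain ⟨η, hη, H⟩ := Metric.eventually_nhds_iff.1 h1
    exact ⟨η, hη, fun A hA => H (by simpa using hA)⟩
  set τ : ℝ := min δ (η / (|C| + 1)) with hτ
  have hC1 : 0 < |C| + 1 := by positivity
  have hτpos : 0 < τ := lt_min hδ (by positivity)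
  have key : ∀ t, 0 < t → t < τ →
      ∫ x in ball (0 : Euc n) r, (1 + t • fderiv ℝ h x).det
        = volume.real (ball (0 : Euc n) r) := by
    intro t ht0 ht
    obtain ⟨hinj, himg⟩ := hsmall t ht0 (ht.trans_le (min_le_left _ _))
    have hd : ∀ x ∈ ball (0 : Euc n) r,
        HasFDerivWithinAt (fun x => x + t • h x) (1 + t • fderiv ℝ h x) (ball 0 r) x := by
      intro x _
      exact ((hasFDerivAt_id x).add
        (((hh.differentiable one_ne_zero) x).hasFDerivAt.const_smul t)).hasFDerivWithinAt
    have hcv := integral_image_eq_integral_abs_det_fderiv_smul volume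
      (measurableSet_ball (x := (0 : Euc n)) (ε := r)) hd hinj (fun _ => (1 : ℝ))
    rw [himg] at hcv
    simp only [smul_eq_mul, mul_one, integral_const, measureReal_restrict_apply_univ] at hcv
    rw [hcv]
    refine setIntegral_congr_fun isOpen_ball.measurableSet fun x hx => ?_
    refine (abs_of_pos (hηpos _ ?_)).symm
    rw [norm_smul, Real.norm_of_nonneg ht0.le]
    have h1 : ‖fderiv ℝ h x‖ ≤ |C| := (hC x (ball_subset_closedBall hx)).trans (le_abs_self C)
    have h2 : t < η / (|C| + 1) := ht.trans_le (min_le_right _ _)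
    rw [lt_div_iff₀ hC1] at h2
    nlinarith
  let v : Fin (n + 1) → ℝ := fun i => τ / (i + 2)
  have hv : Function.Injective v := by
    intro i j hij
    have h1 : (0 : ℝ) < (i : ℕ) + 2 := by positivity
    have h2 : (0 : ℝ) < (j : ℕ) + 2 := by positivity
    simp only [v] at hij
    rw [div_eq_div_iff h1.ne' h2.ne'] at hij
    have := mul_left_cancel₀ hτpos.ne' hij
    have h3 : ((j : ℕ) : ℝ) = (i : ℕ) := by linarith
    exact Fin.ext (by exact_mod_cast h3.symm)
  have hvi : ∀ i, 0 < v i ∧ v i < τ := fun i => by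
    have h1 : (0 : ℝ) ≤ (i : ℕ) := by positivity
    refine ⟨by simp only [v]; positivity, ?_⟩
    simp only [v]
    rw [div_lt_iff₀ (by positivity)]
    nlinarith
  rw [show (fun x => (1 + fderiv ℝ h x).det) = _ from
    funext fun x => det_one_add_eq_sum_lagrange v hv (fderiv ℝ h x), integral_finsetSum]
  · simp_rw [integral_const_mul, key _ (hvi _).1 (hvi _).2]
    rw [← Finset.sum_mul, ← Polynomial.eval_finsetSum,
      Lagrange.sum_basis hv.injOn Finset.univ_nonempty, Polynomial.eval_one, one_mul]
  · intro i _
    refine Integrable.const_mul ?_ _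
    have : Continuous fun x => (1 + v i • fderiv ℝ h x).det :=
      hdet.comp (continuous_const.add (hcont.fun_const_smul (v i)))
    exact (this.continuousOn.integrableOn_compact (isCompact_closedBall (0 : Euc n) r)).mono_set
      ball_subset_closedBall

/-- If the perturbed identity has constant nonzero norm near `x`, its derivative is singular. -/
theorem det_one_add_fderiv_eq_zero {n : ℕ} {h : Euc n → Euc n} {x : Euc n}
    (hh : DifferentiableAt ℝ h x) {r : ℝ} (hr : 0 < r)
    (hnorm : ∀ᶠ y in nhds x, ‖y + h y‖ = r) : (1 + fderiv ℝ h x).det = 0 := by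
  by_contra hdet
  have hd : HasFDerivAt (fun y => y + h y) (1 + fderiv ℝ h x) x :=
    (hasFDerivAt_id x).add hh.hasFDerivAt
  have hsq := hd.norm_sq
  have hconst : HasFDerivAt (fun y => ‖y + h y‖ ^ 2) (0 : Euc n →L[ℝ] ℝ) x :=
    (hasFDerivAt_const (r ^ 2) x).congr_of_eventuallyEq (hnorm.mono fun y hy => by simp [hy])
  have heq := hsq.unique hconst
  have hu : IsUnit (LinearMap.det ((1 + fderiv ℝ h x : Euc n →L[ℝ] Euc n) : Euc n →ₗ[ℝ] Euc n)) :=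
    isUnit_iff_ne_zero.2 hdet
  obtain ⟨w, hw⟩ := (LinearMap.equivOfIsUnitDet hu).surjective (x + h x)
  rw [LinearMap.equivOfIsUnitDet_apply] at hw
  have hw' : (1 + fderiv ℝ h x) w = x + h x := hw
  have h1 := congrArg (fun L => L w) heq
  have hx := hnorm.self_of_nhds
  simp only [smul_apply, ContinuousLinearMap.comp_apply, hw',
    innerSL_apply_apply, real_inner_self_eq_norm_sq, hx, zero_apply] at h1
  simp [hr.ne'] at h1

/-- A continuous self-map of Euclidean space that is the identity outside a ball vanishes
somewhere. -/
theorem exists_eq_zero_of_eq_id_outside {n : ℕ} {u : Euc n → Euc n} (hu : Continuous u) (R : ℝ)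
    (hR : ∀ x, R ≤ ‖x‖ → u x = x) : ∃ x, u x = 0 := by
  by_contra! hne
  wlog hR0 : 0 < R generalizing R
  · exact this 1 (fun x hx => hR x (by linarith)) one_pos
  obtain ⟨w, hw, hwd, hwS, -⟩ := hu.exists_contDiff_approx_and_eqOn (1 : ℕ∞) hu.norm
    (fun x => norm_pos_iff.2 (hne x)) (S := {x | R + 1 ≤ ‖x‖}) (U := {x | R < ‖x‖})
    (isClosed_le continuous_const continuous_norm)
    ((isOpen_lt continuous_const continuous_norm).mem_nhdsSet.2 fun x hx => by
      simp only [mem_ofPred_eq] at hx ⊢; linarith)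
    (contDiffOn_id.congr fun x hx => hR x (le_of_lt hx))
  have hw0 : ∀ x, w x ≠ 0 := fun x hx => by
    have := hwd x
    rw [hx, dist_zero_left] at this
    exact lt_irrefl _ this
  have hwid : ∀ x, R + 1 ≤ ‖x‖ → w x = x := fun x hx => by
    rw [hwS hx, hR x (by linarith)]
  set r : ℝ := R + 1 with hr
  have hrpos : 0 < r := by linarith
  let b : ContDiffBump (0 : Euc n) := ⟨r, r + 1, hrpos, by linarith⟩
  let h : Euc n → Euc n := fun x => b x • ((r / ‖w x‖) • w x - x)
  have hw1 : ContDiff ℝ 1 w := hw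
  have hh : ContDiff ℝ 1 h := by
    have hq : ContDiff ℝ 1 fun x => r / ‖w x‖ :=
      contDiff_const.div (hw1.norm ℝ hw0) fun x => norm_ne_zero_iff.2 (hw0 x)
    exact b.contDiff.smul ((hq.smul hw1).sub contDiff_id)
  have hsupp : HasCompactSupport h := b.hasCompactSupport.smul_right
  obtain ⟨K, hK⟩ := hh.lipschitzWith_of_hasCompactSupport hsupp one_ne_zero
  have hin : ∀ x, ‖x‖ ≤ r → x + h x = (r / ‖w x‖) • w x := fun x hx => by
    have : b x = 1 := b.one_of_mem_closedBall (by simpa using hx)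
    simp [h, this]
  have hnormw : ∀ x, ‖(r / ‖w x‖) • w x‖ = r := fun x => by
    rw [norm_smul, norm_div, norm_norm, div_mul_cancel₀ _ (norm_ne_zero_iff.2 (hw0 x)),
      Real.norm_of_nonneg hrpos.le]
  have hball : ∀ t : ℝ, 0 < t → t < 1 → ∀ x, ‖x‖ < r → ‖x + t • h x‖ < r := by
    intro t ht0 ht1 x hx
    have h1 : x + t • h x = (1 - t) • x + t • (x + h x) := by
      rw [smul_add, sub_smul, one_smul]; abel
    rw [h1, hin x hx.le]
    refine (norm_add_le _ _).trans_lt ?_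
    rw [norm_smul, norm_smul, hnormw, Real.norm_of_nonneg ht0.le,
      Real.norm_of_nonneg (sub_nonneg.2 ht1.le)]
    nlinarith
  have hout : ∀ t : ℝ, 0 < t → t < 1 → ∀ x, r ≤ ‖x‖ → r ≤ ‖x + t • h x‖ := by
    intro t ht0 ht1 x hx
    have hxpos : 0 < ‖x‖ := hrpos.trans_le hx
    have hb0 : 0 ≤ b x := b.nonneg
    have hb1 : b x ≤ 1 := b.le_one
    have h1 : x + t • h x = (1 - t * b x * (1 - r / ‖x‖)) • x := by
      simp only [h, hwid x hx]
      module
    have hq0 : 0 ≤ 1 - r / ‖x‖ := by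
      rw [sub_nonneg, div_le_one hxpos]; exact hx
    have hs0 : 0 ≤ t * b x := by positivity
    have hs1 : t * b x ≤ 1 := by nlinarith
    have hc : r / ‖x‖ ≤ 1 - t * b x * (1 - r / ‖x‖) := by nlinarith
    rw [h1, norm_smul]
    calc r = r / ‖x‖ * ‖x‖ := by field_simp
      _ ≤ (1 - t * b x * (1 - r / ‖x‖)) * ‖x‖ := by gcongr
      _ ≤ _ := by gcongr; exact Real.le_norm_self _
  have hintegral := integral_det_one_add_eq_volume hh r (min 1 (1 / (K + 1))) (by positivity) ?_
  · have hz : ∫ x in ball (0 : Euc n) r, (1 + fderiv ℝ h x).det = 0 := by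
      refine MeasureTheory.setIntegral_eq_zero_of_forall_eq_zero fun x hx => ?_
      refine det_one_add_fderiv_eq_zero (hh.differentiable one_ne_zero x) hrpos ?_
      filter_upwards [isOpen_ball.mem_nhds hx] with y hy
      rw [hin y (by simpa using (mem_ball_zero_iff.1 hy).le), hnormw]
    rw [hz] at hintegral
    have : 0 < MeasureTheory.volume.real (ball (0 : Euc n) r) :=
      ENNReal.toReal_pos (measure_ball_pos _ _ hrpos).ne' MeasureTheory.measure_ball_lt_top.ne
    linarith
  · intro t ht0 ht
    have ht1 : t < 1 := ht.trans_le (min_le_left _ _)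
    have htK : t * K < 1 := by
      have h2 : t < 1 / (K + 1) := ht.trans_le (min_le_right _ _)
      rw [lt_div_iff₀ (by positivity)] at h2
      nlinarith
    have happ : ApproximatesLinearOn (fun x => x + t • h x)
        ((ContinuousLinearEquiv.refl ℝ (Euc n) : Euc n ≃L[ℝ] Euc n) : Euc n →L[ℝ] Euc n) univ
        (t.toNNReal * K) := by
      intro x _ y _
      have h1 : x + t • h x - (y + t • h y) -
          ((ContinuousLinearEquiv.refl ℝ (Euc n) : Euc n ≃L[ℝ] Euc n) : Euc n →L[ℝ] Euc n) (x - y)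
            = t • (h x - h y) := by
        simp only [ContinuousLinearEquiv.coe_refl, ContinuousLinearMap.id_apply, smul_sub]
        abel
      rw [h1, norm_smul, Real.norm_of_nonneg ht0.le]
      have h2 := hK.norm_sub_le x y
      rw [NNReal.coe_mul, Real.coe_toNNReal _ ht0.le, mul_assoc]
      gcongr
    have hc : Subsingleton (Euc n) ∨ t.toNNReal * K <
        ‖((ContinuousLinearEquiv.refl ℝ (Euc n)).symm : Euc n →L[ℝ] Euc n)‖₊⁻¹ := by
      rcases subsingleton_or_nontrivial (Euc n) with hs | hs
      · exact Or.inl hs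
      · right
        rw [← NNReal.coe_lt_coe]
        simpa [Real.coe_toNNReal _ ht0.le] using htK
    refine ⟨(happ.injOn hc).mono (subset_univ _), ?_⟩
    apply Subset.antisymm
    · rintro _ ⟨x, hx, rfl⟩
      simpa using hball t ht0 ht1 x (by simpa using hx)
    · intro y hy
      obtain ⟨x, hx⟩ := happ.surjective hc y
      refine ⟨x, ?_, hx⟩
      by_contra hxb
      have h1 := hout t ht0 ht1 x (by simpa using hxb)
      have h2 : ‖x + t • h x‖ < r := by simpa [← hx] using hy
      linarith

/-- A continuous self-map of a subset of Euclidean space homeomorphic to an open set, which is the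
identity outside a compact set, is surjective. -/
theorem surjective_of_eq_id_off_compact {n : ℕ} {N O : Set (Euc n)} (hO : IsOpen O) (e : N ≃ₜ O)
    {Q : N → N} (hQ : Continuous Q) {K : Set N} (hK : IsCompact K)
    (hQK : ∀ y ∉ K, Q y = y) : Function.Surjective Q := by
  classical
  intro q
  by_contra! hq
  set o : Euc n := (e q : Euc n) with ho
  let U : Euc n → Euc n := fun z => if hz : z ∈ O then (e (Q (e.symm ⟨z, hz⟩)) : Euc n) else z
  let C : Set (Euc n) := (fun y : N => (e y : Euc n)) '' K
  have hC : IsCompact C := hK.image (continuous_subtype_val.comp e.continuous)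
  have hUC : ∀ z ∉ C, U z = z := by
    intro z hz
    by_cases hzO : z ∈ O
    · have : e.symm ⟨z, hzO⟩ ∉ K := fun hk => hz ⟨_, hk, by simp⟩
      simp [U, hzO, hQK _ this]
    · simp [U, hzO]
  have hUo : ∀ z, U z ≠ o := by
    intro z
    by_cases hzO : z ∈ O
    · simp only [U, hzO, dif_pos, ho]
      intro h
      exact hq _ (e.injective (Subtype.ext h))
    · simp only [U, hzO, dif_neg, not_false_eq_true]
      rintro rfl
      exact hzO (e q).2
  have hUcont : Continuous U := by
    have hUO : ContinuousOn U O := by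
      rw [continuousOn_iff_continuous_domRestrict]
      have : O.domRestrict U = fun z : O => (e (Q (e.symm z)) : Euc n) := by
        ext1 z
        simp [U]
      rw [this]
      fun_prop
    rw [continuous_iff_continuousAt]
    intro z
    by_cases hzO : z ∈ O
    · exact hUO.continuousAt (hO.mem_nhds hzO)
    · have hzC : z ∉ C := by
        rintro ⟨y, -, rfl⟩
        exact hzO (e y).2
      refine continuousAt_id.congr ?_
      filter_upwards [hC.isClosed.isOpen_compl.mem_nhds hzC] with w hw
      exact (hUC w hw).symm
  obtain ⟨R, hR⟩ := hC.isBounded.subset_closedBall o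
  obtain ⟨x, hx⟩ := exists_eq_zero_of_eq_id_outside (u := fun z => U (z + o) - o)
    (by fun_prop) (R + 1) fun x hx => by
      rw [hUC, add_sub_cancel_right]
      intro hxC
      have := hR hxC
      rw [mem_closedBall, dist_eq_norm, add_sub_cancel_right] at this
      linarith
  exact hUo _ (sub_eq_zero.1 hx)

/-- The manifold interior of a homeomorphic image of the closed unit ball. -/
theorem mInterior_image_closedBall {n : ℕ} (Φ : Euc n ≃ₜ Euc n) (c : Euc n) :
    mInterior n (Φ '' closedBall c 1) = Φ '' ball c 1 := by
  apply Subset.antisymm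
  · rintro _ ⟨⟨p, hp, rfl⟩, N, hN, hNY, O, hO, ⟨e⟩⟩
    refine ⟨p, ?_, rfl⟩
    by_contra hpb
    have hpc : dist p c = 1 := le_antisymm (mem_closedBall.1 hp) (not_lt.1 hpb)
    obtain ⟨V, hV, hVN⟩ := mem_nhdsWithin_iff_exists_mem_nhds_inter.1 hN
    obtain ⟨r, hr, hrV⟩ := Metric.mem_nhds_iff.1 (Φ.continuous.continuousAt.preimage_mem_nhds hV)
    set ε : ℝ := min 1 (r / 3) with hε
    have hεpos : 0 < ε := by positivity
    have hε1 : ε ≤ 1 := min_le_left _ _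
    have hεr : ε ≤ r / 3 := min_le_right _ _
    have hnear : ∀ p' ∈ closedBall c 1, dist p' p ≤ 2 * ε → Φ p' ∈ N := fun p' hp' hd =>
      hVN ⟨hrV (mem_ball.2 (by linarith)), p', hp', rfl⟩
    let s : Euc n → ℝ := fun p' => max 0 (ε - dist p' p)
    have hs0 : ∀ p', 0 ≤ s p' := fun p' => le_max_left _ _
    have hsε : ∀ p', s p' ≤ ε := fun p' => by
      exact max_le hεpos.le (by linarith [dist_nonneg (x := p') (y := p)])
    let push : Euc n → Euc n := fun p' => p' + s p' • (c - p')
    have hpushc : ∀ p', dist (push p') c = (1 - s p') * dist p' c := fun p' => by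
      have : push p' - c = (1 - s p') • (p' - c) := by simp only [push]; module
      rw [dist_eq_norm, this, norm_smul, dist_eq_norm,
        Real.norm_of_nonneg (by linarith [hsε p'])]
    have hpushd : ∀ p' ∈ closedBall c 1, dist (push p') p' ≤ ε := fun p' hp' => by
      rw [dist_eq_norm]
      simp only [push, add_sub_cancel_left]
      rw [norm_smul, Real.norm_of_nonneg (hs0 p'), ← dist_eq_norm, dist_comm]
      nlinarith [hsε p', hs0 p', mem_closedBall.1 hp']
    have hpushmem : ∀ p' ∈ closedBall c 1, push p' ∈ closedBall c 1 := fun p' hp' => by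
      rw [mem_closedBall, hpushc]
      nlinarith [hsε p', hs0 p', mem_closedBall.1 hp', dist_nonneg (x := p') (y := c)]
    have hpushid : ∀ p', ε ≤ dist p' p → push p' = p' := fun p' hd => by
      have : s p' = 0 := max_eq_left (by linarith)
      simp [push, this]
    have hpushne : ∀ p' ∈ closedBall c 1, push p' ≠ p := fun p' hp' h => by
      have h1 := hpushc p'
      rw [h, hpc] at h1
      have h2 := mem_closedBall.1 hp'
      have h3 : s p' = 0 := by
        by_contra h0
        have : 0 < s p' := lt_of_le_of_ne (hs0 p') (Ne.symm h0)
        nlinarith [hsε p']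
      have h4 : p' = p := by simpa [push, h3] using h
      have h5 : s p' = ε := by simp [s, h4, hεpos.le]
      linarith
    have hpushcont : Continuous push := by
      simp only [push, s]; fun_prop
    have hsymm : ∀ y : N, Φ.symm y ∈ closedBall c 1 := fun y => by
      obtain ⟨p', hp', h⟩ := hNY y.2
      rw [← h]; simpa using hp'
    have hmem : ∀ y : N, Φ (push (Φ.symm y)) ∈ N := fun y => by
      rcases le_total ε (dist (Φ.symm y) p) with h | h
      · rw [hpushid _ h]; simp
      · refine hnear _ (hpushmem _ (hsymm y)) ?_
        have := dist_triangle (push (Φ.symm y)) (Φ.symm y) p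
        linarith [hpushd _ (hsymm y)]
    let Q : N → N := fun y => ⟨Φ (push (Φ.symm y)), hmem y⟩
    have hQ : Continuous Q :=
      Continuous.subtype_mk (by fun_prop) _
    let K : Set (Euc n) := Φ '' (closedBall p ε ∩ closedBall c 1)
    have hK : IsCompact K :=
      ((isCompact_closedBall p ε).inter_right isClosed_closedBall).image Φ.continuous
    have hKN : K ⊆ N := by
      rintro _ ⟨p', ⟨h1, h2⟩, rfl⟩
      exact hnear p' h2 (by linarith [mem_closedBall.1 h1])
    have hK' : IsCompact ((↑) ⁻¹' K : Set N) :=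
      Topology.IsInducing.subtypeVal.isCompact_preimage' hK (by simpa using hKN)
    have hsurj := surjective_of_eq_id_off_compact hO e hQ hK' fun y hy => by
      apply Subtype.ext
      have : ε ≤ dist (Φ.symm y) p := by
        by_contra! h
        exact hy ⟨Φ.symm y, ⟨mem_closedBall.2 h.le, hsymm y⟩, by simp⟩
      simp [Q, hpushid _ this]
    obtain ⟨y, hy⟩ := hsurj ⟨Φ p, hnear p hp (by simp [hεpos.le])⟩
    exact hpushne _ (hsymm y) (Φ.injective (congrArg Subtype.val hy))
  · rintro _ ⟨p, hp, rfl⟩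
    have hopen : IsOpen (Φ '' ball c 1) := Φ.isOpenMap _ isOpen_ball
    exact ⟨mem_image_of_mem _ (ball_subset_closedBall hp), Φ '' ball c 1,
      mem_nhdsWithin_of_mem_nhds (hopen.mem_nhds (mem_image_of_mem _ hp)),
      image_mono ball_subset_closedBall, Φ '' ball c 1, hopen, ⟨Homeomorph.refl _⟩⟩

/-- A homeomorphic image of the closed unit ball is a manifold with boundary: inversion at a
boundary point `a` maps the ball punctured at `a` onto a half-space. -/
theorem isC0ManifoldWithBoundary_image_closedBall {n : ℕ} (hn : 0 < n) (Φ : Euc n ≃ₜ Euc n)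
    (c : Euc n) : IsC0ManifoldWithBoundary n hn (Φ '' closedBall c 1) := by
  rintro _ ⟨p, hp, rfl⟩
  set b : Euc n := EuclideanSpace.single ⟨0, hn⟩ (1 : ℝ) with hb
  have hbn : ‖b‖ = 1 := by simp [hb]
  have hbi : ∀ v : Euc n, inner ℝ v b = v ⟨0, hn⟩ := fun v => by
    simp [hb, EuclideanSpace.inner_single_right]
  obtain ⟨s, hs, hps⟩ : ∃ s : ℝ, s * s = 1 ∧ p ≠ c - s • b := by
    by_cases h : p = c - (1 : ℝ) • b
    · refine ⟨-1, by norm_num, fun h' => ?_⟩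
      have h2 : (2 : ℝ) • b = (c - (-1 : ℝ) • b) - (c - (1 : ℝ) • b) := by module
      rw [← h', ← h, sub_self] at h2
      have h3 : b = 0 := (smul_eq_zero.1 h2).resolve_left two_ne_zero
      simp [h3] at hbn
    · exact ⟨1, by norm_num, h⟩
  set a : Euc n := c - s • b with ha
  have hmem : ∀ v : Euc n, v ∈ closedBall c 1 ↔ ‖v - a‖ ^ 2 ≤ 2 * (s • (v - a)) ⟨0, hn⟩ := by
    intro v
    have h1 : v - c = (v - a) - s • b := by rw [ha]; module
    rw [mem_closedBall, dist_eq_norm, ← sq_le_one_iff₀ (norm_nonneg _), h1, norm_sub_sq_real,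
      norm_smul, inner_smul_right, hbi, hbn, mul_one, PiLp.smul_apply, smul_eq_mul]
    have : ‖s‖ ^ 2 = 1 := by rw [Real.norm_eq_abs, sq_abs, sq, hs]
    rw [this]
    constructor <;> intro h <;> linarith
  set H : Euc n := (1 / 2 : ℝ) • b with hH
  have hHb : ∀ w : Euc n, (w + H) ⟨0, hn⟩ = w ⟨0, hn⟩ + 1 / 2 := fun w => by simp [hH, hb]
  have hN : Φ '' (closedBall c 1 \ {a}) ∈ nhdsWithin (Φ p) (Φ '' closedBall c 1) := by
    have h1 : (Φ '' {a})ᶜ ∈ nhds (Φ p) := by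
      refine (Φ.isClosedMap _ isClosed_singleton).isOpen_compl.mem_nhds ?_
      rintro ⟨q, hq, hqp⟩
      exact hps ((Φ.injective hqp).symm.trans hq)
    rw [image_sdiff Φ.injective]
    exact inter_mem self_mem_nhdsWithin (mem_nhdsWithin_of_mem_nhds h1)
  have hinv : ∀ v : Euc n, v ≠ 0 → (‖(‖v‖ ^ 2)⁻¹ • v‖ ^ 2)⁻¹ • ((‖v‖ ^ 2)⁻¹ • v) = v := by
    intro v hv
    have : ‖v‖ ≠ 0 := norm_ne_zero_iff.2 hv
    rw [norm_smul, smul_smul, norm_inv, norm_pow, norm_norm]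
    convert one_smul ℝ v using 2
    field_simp
  have hss : ∀ v : Euc n, s • s • v = v := fun v => by rw [smul_smul, hs, one_smul]
  have hns : ∀ v : Euc n, ‖s • v‖ = ‖v‖ := fun v => by
    have : |s| = 1 := by
      have := abs_mul_abs_self s
      rw [hs] at this
      nlinarith [abs_nonneg s]
    rw [norm_smul, Real.norm_eq_abs, this, one_mul]
  have hs0 : s ≠ 0 := fun h => by simp [h] at hs
  have hHne : ∀ w ∈ closedHalfSpace n hn, w + H ≠ 0 := fun w hw h => by
    have h1 := hHb w
    rw [h] at h1
    simp only [closedHalfSpace, mem_ofPred_eq] at hw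
    simp only [PiLp.zero_apply] at h1
    linarith
  let f : Euc n → Euc n := fun y => (‖Φ.symm y - a‖ ^ 2)⁻¹ • (s • (Φ.symm y - a)) - H
  let g : Euc n → Euc n := fun w => Φ (a + s • ((‖w + H‖ ^ 2)⁻¹ • (w + H)))
  have hf : MapsTo f (Φ '' (closedBall c 1 \ {a})) (closedHalfSpace n hn) := by
    rintro _ ⟨v, ⟨hv, hva⟩, rfl⟩
    have h0 : 0 < ‖v - a‖ ^ 2 := by
      have : 0 < ‖v - a‖ := norm_pos_iff.2 (sub_ne_zero.2 hva)
      positivity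
    have h1 := (hmem v).1 hv
    have h2 := hHb (f (Φ v))
    simp only [f, Homeomorph.symm_apply_apply, sub_add_cancel] at h2
    rw [PiLp.smul_apply, smul_eq_mul] at h2
    change 0 ≤ f (Φ v) ⟨0, hn⟩
    simp only [f, Homeomorph.symm_apply_apply]
    have h3 : 1 / 2 ≤ (‖v - a‖ ^ 2)⁻¹ * (s • (v - a)) ⟨0, hn⟩ := by
      rw [inv_mul_eq_div, le_div_iff₀ h0]; linarith
    linarith
  have hg : MapsTo g (closedHalfSpace n hn) (Φ '' (closedBall c 1 \ {a})) := by
    intro w hw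
    have hw0 := hHne w hw
    have h0 : 0 < ‖w + H‖ := norm_pos_iff.2 hw0
    refine ⟨_, ⟨(hmem _).2 ?_, ?_⟩, rfl⟩
    · rw [add_sub_cancel_left, hss, hns, norm_smul, PiLp.smul_apply, hHb, smul_eq_mul,
        norm_inv, norm_pow, norm_norm]
      have h1 : 0 ≤ w ⟨0, hn⟩ := hw
      rw [mul_pow, sq (_⁻¹), mul_assoc, inv_mul_cancel₀ (by positivity), mul_one]
      have : 0 < (‖w + H‖ ^ 2)⁻¹ := by positivity
      nlinarith
    · rw [mem_singleton_iff, add_eq_left]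
      exact smul_ne_zero hs0 (smul_ne_zero (by positivity) hw0)
  refine ⟨_, hN, image_mono sdiff_subset, closedHalfSpace n hn, ⟨univ, isOpen_univ, by simp⟩,
    ⟨{ toFun := fun y => ⟨f y, hf y.2⟩
       invFun := fun w => ⟨g w, hg w.2⟩
       left_inv := ?_
       right_inv := ?_
       continuous_toFun := ?_
       continuous_invFun := ?_ }⟩⟩
  · rintro ⟨_, v, ⟨hv, hva⟩, rfl⟩
    apply Subtype.ext
    have h := hinv (s • (v - a)) (smul_ne_zero hs0 (sub_ne_zero.2 hva))
    rw [hns] at h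
    simp only [f, g, Homeomorph.symm_apply_apply, sub_add_cancel, h, hss, add_sub_cancel]
  · rintro ⟨w, hw⟩
    apply Subtype.ext
    have h := hinv (w + H) (hHne w hw)
    simp only [f, g, Homeomorph.symm_apply_apply, add_sub_cancel_left, hss, hns, h,
      add_sub_cancel_right]
  · refine Continuous.subtype_mk (Continuous.sub (Continuous.fun_smul
      (Continuous.inv₀ (by fun_prop) ?_) (by fun_prop)) continuous_const) _
    rintro ⟨_, v, ⟨hv, hva⟩, rfl⟩
    simpa using sub_ne_zero.2 hva
  · refine Continuous.subtype_mk (Φ.continuous.comp (continuous_const.add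
      (Continuous.fun_const_smul (Continuous.fun_smul
        (Continuous.inv₀ (by fun_prop) ?_) (by fun_prop)) s))) _
    intro w
    exact pow_ne_zero _ (norm_ne_zero_iff.2 (hHne w w.2))

/-- One frequency of the corrugation: a wave of frequency `5 ^ m` in the slope `x / z`, living at
heights `z` comparable to `4 ^ (-m)` and slopes in `[-1, 2]`. -/
def corrugationTerm (m : ℕ) (p : ℝ × ℝ) : ℝ :=
  7 * (1 / 2) ^ m * (Real.smoothTransition (4 ^ (m + 1) * p.2 - 1) *
    Real.smoothTransition (5 - 4 ^ m * p.2) * (Real.smoothTransition (1 + p.1 / p.2) *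
      Real.smoothTransition (2 - p.1 / p.2))) * Real.cos (Real.pi * (5 ^ m * (p.1 / p.2)))

/-- The corrugation: the sum of all its frequencies. -/
def corrugation (p : ℝ × ℝ) : ℝ := ∑' m, corrugationTerm m p

theorem corrugationTerm_amplitude_mem (m : ℕ) (p : ℝ × ℝ) :
    Real.smoothTransition (4 ^ (m + 1) * p.2 - 1) *
    Real.smoothTransition (5 - 4 ^ m * p.2) * (Real.smoothTransition (1 + p.1 / p.2) *
      Real.smoothTransition (2 - p.1 / p.2)) ∈ Icc (0 : ℝ) 1 := by
  have h0 := Real.smoothTransition.nonneg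
  have h1 := Real.smoothTransition.le_one
  refine ⟨mul_nonneg (mul_nonneg (h0 _) (h0 _)) (mul_nonneg (h0 _) (h0 _)), ?_⟩
  exact mul_le_one₀ (mul_le_one₀ (h1 _) (h0 _) (h1 _)) (mul_nonneg (h0 _) (h0 _))
    (mul_le_one₀ (h1 _) (h0 _) (h1 _))

theorem norm_corrugationTerm_le (m : ℕ) (p : ℝ × ℝ) :
    ‖corrugationTerm m p‖ ≤ 7 * (1 / 2) ^ m := by
  obtain ⟨h0, h1⟩ := corrugationTerm_amplitude_mem m p
  rw [corrugationTerm, norm_mul, norm_mul, Real.norm_of_nonneg h0, Real.norm_of_nonneg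
    (by positivity : (0 : ℝ) ≤ 7 * (1 / 2) ^ m)]
  have h2 := Real.abs_cos_le_one (Real.pi * (5 ^ m * (p.1 / p.2)))
  rw [← Real.norm_eq_abs] at h2
  have h3 : (0 : ℝ) ≤ 7 * (1 / 2) ^ m := by positivity
  exact mul_le_of_le_one_right (by positivity) h2 |>.trans (mul_le_of_le_one_right h3 h1)

theorem summable_corrugation_bound : Summable fun m : ℕ => (7 : ℝ) * (1 / 2) ^ m :=
  summable_geometric_two.mul_left 7

theorem summable_corrugationTerm (p : ℝ × ℝ) : Summable fun m => corrugationTerm m p :=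
  .of_norm_bounded summable_corrugation_bound fun m => norm_corrugationTerm_le m p

theorem corrugationTerm_eq_zero_of_low {m : ℕ} {p : ℝ × ℝ} (h : 4 ^ (m + 1) * p.2 ≤ 1) :
    corrugationTerm m p = 0 := by
  simp [corrugationTerm, Real.smoothTransition.zero_of_nonpos (sub_nonpos.2 h)]

theorem corrugationTerm_eq_zero_of_high {m : ℕ} {p : ℝ × ℝ} (h : 5 ≤ 4 ^ m * p.2) :
    corrugationTerm m p = 0 := by
  simp [corrugationTerm, Real.smoothTransition.zero_of_nonpos (sub_nonpos.2 h)]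

theorem contDiffAt_corrugationTerm (m : ℕ) {p : ℝ × ℝ} (hp : 0 < p.2) :
    ContDiffAt ℝ 1 (corrugationTerm m) p := by
  have hs : ∀ {f : ℝ × ℝ → ℝ}, ContDiffAt ℝ 1 f p →
      ContDiffAt ℝ 1 (fun q => Real.smoothTransition (f q)) p := fun hf =>
    Real.smoothTransition.contDiff.contDiffAt.comp p hf
  have hd : ContDiffAt ℝ 1 (fun q : ℝ × ℝ => q.1 / q.2) p :=
    contDiffAt_fst.div contDiffAt_snd hp.ne'
  have hsnd : ContDiffAt ℝ 1 (fun q : ℝ × ℝ => q.2) p := contDiffAt_snd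
  have h1 := hs ((contDiffAt_const (c := (4 : ℝ) ^ (m + 1))).mul hsnd |>.sub
    (contDiffAt_const (c := (1 : ℝ))))
  have h2 := hs ((contDiffAt_const (c := (5 : ℝ))).sub
    ((contDiffAt_const (c := (4 : ℝ) ^ m)).mul hsnd))
  have h3 := hs ((contDiffAt_const (c := (1 : ℝ))).add hd)
  have h4 := hs ((contDiffAt_const (c := (2 : ℝ))).sub hd)
  have h5 : ContDiffAt ℝ 1 (fun q : ℝ × ℝ => Real.cos (Real.pi * (5 ^ m * (q.1 / q.2)))) p :=
    ((contDiffAt_const (c := Real.pi)).mul ((contDiffAt_const (c := (5 : ℝ) ^ m)).mul hd)).cos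
  exact ((contDiffAt_const (c := (7 : ℝ) * (1 / 2) ^ m)).mul ((h1.mul h2).mul (h3.mul h4))).mul h5

theorem continuous_corrugation : Continuous corrugation := by
  refine continuous_tsum (fun m => ?_) summable_corrugation_bound norm_corrugationTerm_le
  rw [continuous_iff_continuousAt]
  intro p
  rcases lt_or_ge 0 p.2 with hp | hp
  · exact (contDiffAt_corrugationTerm m hp).continuousAt
  · refine (continuousAt_const (y := (0 : ℝ))).congr ?_
    have hc : Continuous fun q : ℝ × ℝ => 4 ^ (m + 1) * q.2 := by fun_prop
    have hlt : (4 : ℝ) ^ (m + 1) * p.2 < 1 :=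
      (mul_nonpos_of_nonneg_of_nonpos (by positivity) hp).trans_lt one_pos
    filter_upwards [hc.continuousAt.eventually_lt_const hlt] with q hq
    exact (corrugationTerm_eq_zero_of_low hq.le).symm

theorem contDiffAt_corrugation {p : ℝ × ℝ} (hp : 0 < p.2) : ContDiffAt ℝ 1 corrugation p := by
  obtain ⟨M, hM⟩ := pow_unbounded_of_one_lt (5 / (p.2 / 2)) (by norm_num : (1 : ℝ) < 4)
  have hev : corrugation =ᶠ[nhds p] fun q => ∑ m ∈ Finset.range M, corrugationTerm m q := by
    have : ∀ᶠ q : ℝ × ℝ in nhds p, p.2 / 2 < q.2 :=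
      continuous_snd.continuousAt.eventually_const_lt (by linarith)
    filter_upwards [this] with q hq
    refine tsum_eq_sum fun m hm => corrugationTerm_eq_zero_of_high ?_
    have hm' : M ≤ m := by simpa using hm
    have h1 : (4 : ℝ) ^ M ≤ 4 ^ m := pow_le_pow_right₀ (by norm_num) hm'
    rw [div_lt_iff₀ (by linarith)] at hM
    calc (5 : ℝ) ≤ 4 ^ M * (p.2 / 2) := hM.le
      _ ≤ 4 ^ m * q.2 := by gcongr
  exact (ContDiffAt.sum fun m _ => contDiffAt_corrugationTerm m hp).congr_of_eventuallyEq hev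

theorem corrugation_eq_zero {p : ℝ × ℝ} (h : p.1 ≤ -p.2 ∨ 2 * p.2 ≤ p.1) (hp : 0 ≤ p.2) :
    corrugation p = 0 := by
  refine (tsum_congr fun m => ?_).trans tsum_zero
  rcases hp.eq_or_lt with hp | hp
  · exact corrugationTerm_eq_zero_of_low (by simp [← hp])
  · rcases h with h | h
    · have : 1 + p.1 / p.2 ≤ 0 := by
        have : p.1 / p.2 ≤ -1 := by rw [div_le_iff₀ hp]; linarith
        linarith
      simp [corrugationTerm, Real.smoothTransition.zero_of_nonpos this]
    · have : 2 - p.1 / p.2 ≤ 0 := by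
        rw [sub_nonpos, le_div_iff₀ hp]; linarith
      simp [corrugationTerm, Real.smoothTransition.zero_of_nonpos this]

theorem cos_pi_mul_int_sq (i : ℤ) : Real.cos (Real.pi * i) * Real.cos (Real.pi * i) = 1 := by
  have h1 : Real.sin (Real.pi * i) = 0 := by rw [mul_comm]; exact Real.sin_int_mul_pi i
  have := Real.sin_sq_add_cos_sq (Real.pi * i)
  rw [h1] at this
  linarith

theorem cos_pi_mul_odd_pow_mul_int (d : ℕ) (i : ℤ) :
    Real.cos (Real.pi * (5 ^ d * i)) = Real.cos (Real.pi * i) := by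
  have h : (5 : ℤ) ^ d ≡ 1 [ZMOD 2] := by
    simpa using (show (5 : ℤ) ≡ 1 [ZMOD 2] by decide).pow d
  obtain ⟨c, hc⟩ := h.symm.dvd
  have hc' : (5 : ℝ) ^ d = 1 + 2 * c := by
    have : (5 : ℤ) ^ d = 1 + 2 * c := by linarith
    exact_mod_cast this
  rw [hc', show Real.pi * ((1 + 2 * c) * i) = Real.pi * i + (c * i : ℤ) * (2 * Real.pi) by
    push_cast; ring, Real.cos_add_int_mul_two_pi]

/-- At heights at most `4 ^ (-k)` the corrugation has alternating ridges and valleys along the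
slopes in `[0, 1]` that are multiples of `5 ^ (-k)`. -/
theorem le_cos_mul_corrugation {k : ℕ} {p : ℝ × ℝ} {i : ℤ} (hp : 0 < p.2)
    (hpk : 4 ^ k * p.2 ≤ 1) (hi : p.1 / p.2 = i / 5 ^ k) (hi0 : 0 ≤ i) (hi1 : i ≤ 5 ^ k) :
    3 * Real.sqrt p.2 ≤ Real.cos (Real.pi * i) * corrugation p := by
  have hu0 : 0 ≤ p.1 / p.2 := by
    rw [hi]
    have : (0 : ℝ) ≤ i := by exact_mod_cast hi0
    positivity
  have hu1 : p.1 / p.2 ≤ 1 := by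
    rw [hi, div_le_one (by positivity)]
    exact_mod_cast hi1
  have hcos : ∀ m, k ≤ m →
      Real.cos (Real.pi * (5 ^ m * (p.1 / p.2))) = Real.cos (Real.pi * i) := by
    intro m hm
    rw [← cos_pi_mul_odd_pow_mul_int (m - k) i, hi]
    congr 2
    rw [← Nat.sub_add_cancel hm, pow_add, Nat.add_sub_cancel]
    field_simp
  have hnonneg : ∀ m, 0 ≤ Real.cos (Real.pi * i) * corrugationTerm m p := by
    intro m
    rcases le_or_gt k m with hm | hm
    · rw [corrugationTerm, hcos m hm, mul_left_comm, cos_pi_mul_int_sq, mul_one]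
      exact mul_nonneg (by positivity) (corrugationTerm_amplitude_mem m p).1
    · rw [corrugationTerm_eq_zero_of_low, mul_zero]
      have : (4 : ℝ) ^ (m + 1) ≤ 4 ^ k := pow_le_pow_right₀ (by norm_num) hm
      nlinarith
  have hex : ∃ m : ℕ, 1 ≤ 4 ^ m * p.2 := by
    obtain ⟨M, hM⟩ := pow_unbounded_of_one_lt (1 / p.2) (by norm_num : (1 : ℝ) < 4)
    rw [div_lt_iff₀ hp] at hM
    exact ⟨M, hM.le⟩
  classical
  obtain ⟨m, hm1, hm2, hkm⟩ : ∃ m : ℕ, 1 ≤ 4 ^ m * p.2 ∧ 4 ^ m * p.2 ≤ 4 ∧ k ≤ m := by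
    refine ⟨Nat.find hex, Nat.find_spec hex, ?_, ?_⟩
    · rcases Nat.eq_zero_or_pos (Nat.find hex) with h | h
      · rw [h, pow_zero, one_mul]
        have : (1 : ℝ) ≤ 4 ^ k := one_le_pow₀ (by norm_num)
        nlinarith
      · obtain ⟨j, hj⟩ := Nat.exists_eq_add_one_of_ne_zero h.ne'
        have := Nat.find_min hex (m := j) (by omega)
        rw [hj, pow_succ]
        linarith
    · by_contra! h
      have h1 := Nat.find_spec hex
      have h2 : (4 : ℝ) ^ (Nat.find hex + 1) ≤ 4 ^ k := pow_le_pow_right₀ (by norm_num) h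
      rw [pow_succ] at h2
      nlinarith
  have hterm : Real.cos (Real.pi * i) * corrugationTerm m p = 7 * (1 / 2) ^ m := by
    have e1 : Real.smoothTransition (4 ^ (m + 1) * p.2 - 1) = 1 :=
      Real.smoothTransition.one_of_one_le (by rw [pow_succ]; linarith)
    have e2 : Real.smoothTransition (5 - 4 ^ m * p.2) = 1 :=
      Real.smoothTransition.one_of_one_le (by linarith)
    have e3 : Real.smoothTransition (1 + p.1 / p.2) = 1 :=
      Real.smoothTransition.one_of_one_le (by linarith)
    have e4 : Real.smoothTransition (2 - p.1 / p.2) = 1 :=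
      Real.smoothTransition.one_of_one_le (by linarith)
    rw [corrugationTerm, hcos m hkm, e1, e2, e3, e4, mul_left_comm, cos_pi_mul_int_sq]
    ring
  have hsqrt : Real.sqrt p.2 ≤ 2 * (1 / 2) ^ m := by
    refine Real.sqrt_le_iff.2 ⟨by positivity, ?_⟩
    have h4 : ((1 / 2 : ℝ) ^ m) ^ 2 * 4 ^ m = 1 := by
      rw [← pow_mul, mul_comm m 2, pow_mul, ← mul_pow]; norm_num
    have hpos : (0 : ℝ) < 4 ^ m := by positivity
    rw [mul_pow]
    by_contra! h
    nlinarith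
  have hsum := (summable_corrugationTerm p).mul_left (Real.cos (Real.pi * i))
  have hle := hsum.le_tsum m fun j _ => hnonneg j
  rw [tsum_mul_left] at hle
  rw [corrugation]
  have : (0 : ℝ) < (1 / 2) ^ m := by positivity
  linarith

theorem mul_le_eVariationOn_of_steps {E : Type*} [PseudoEMetricSpace E] {γ : ℝ → E} {u : ℝ → ℝ}
    {c : ENNReal} {α δ a : ℝ} (r : ℕ) {b : ℝ} (hab : a ≤ b) (hu : ContinuousOn u (Icc a b))
    (ha : u a = α) (hb : u b = α + r * δ)
    (h : ∀ l < r, ∀ s t, a ≤ s → s ≤ t → t ≤ b → u s = α + l * δ → u t = α + (l + 1) * δ →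
      c ≤ eVariationOn γ (Icc s t)) :
    r * c ≤ eVariationOn γ (Icc a b) := by
  induction r generalizing b with
  | zero => simp
  | succ r ih =>
    have hmem : α + r * δ ∈ uIcc (u a) (u b) := by
      rw [ha, hb]
      push_cast
      rcases le_total 0 δ with hδ | hδ
      · refine mem_uIcc_of_le ?_ ?_ <;> nlinarith [mul_nonneg (Nat.cast_nonneg (α := ℝ) r) hδ]
      · refine mem_uIcc_of_ge ?_ ?_ <;>
          nlinarith [mul_nonneg (Nat.cast_nonneg (α := ℝ) r) (neg_nonneg.2 hδ)]
    obtain ⟨t, ht, htu⟩ := intermediate_value_uIcc (by rwa [uIcc_of_le hab]) hmem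
    rw [uIcc_of_le hab] at ht
    have h1 := ih ht.1 (hu.mono (Icc_subset_Icc_right ht.2)) htu fun l hl s s' h1 h2 h3 =>
      h l (by omega) s s' h1 h2 (h3.trans ht.2)
    have h2 := h r (by omega) t b ht.1 ht.2 le_rfl htu (by rw [hb]; push_cast; ring)
    have h3 := eVariationOn.Icc_add_Icc γ ht.1 ht.2 (mem_univ t)
    simp only [univ_inter] at h3
    rw [← h3]
    push_cast
    rw [add_mul, one_mul]
    exact add_le_add h1 h2

theorem ofReal_abs_coord_sub_le_eVariationOn {n : ℕ} (γ : ℝ → Euc n) (i : Fin n) {a b s t : ℝ}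
    (hs : s ∈ Icc a b) (ht : t ∈ Icc a b) :
    ENNReal.ofReal |γ s i - γ t i| ≤ eVariationOn γ (Icc a b) := by
  refine le_trans ?_ (eVariationOn.edist_le γ hs ht)
  rw [edist_dist, dist_eq_norm]
  exact ENNReal.ofReal_le_ofReal (PiLp.norm_apply_le (γ s - γ t) i)

/-- The points whose second coordinate is within `√(2 z)` of the corrugation, `z > 0` being their
third coordinate. -/
def corrugatedTrough (n : ℕ) : Set (Euc (n + 3)) :=
  {v | 0 < v 2 ∧ (v 1 - corrugation (v 0, v 2)) ^ 2 ≤ 2 * v 2}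

theorem abs_sub_corrugation_le {n : ℕ} {v : Euc (n + 3)} (hv : v ∈ corrugatedTrough n) :
    |v 1 - corrugation (v 0, v 2)| ≤ 3 / 2 * √(v 2) := by
  have h := Real.sq_sqrt hv.1.le
  refine abs_le_of_sq_le_sq ?_ (by positivity)
  nlinarith [hv.2]

/-- Crossing one wave of the corrugation from ridge to valley costs at least the heights. -/
theorem le_abs_sub_of_adjacent {n k : ℕ} {v w : Euc (n + 3)} (hv : v ∈ corrugatedTrough n)
    (hw : w ∈ corrugatedTrough n) (hvk : 4 ^ k * v 2 ≤ 1) (hwk : 4 ^ k * w 2 ≤ 1) {i j : ℤ}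
    (hi : v 0 / v 2 = i / 5 ^ k) (hj : w 0 / w 2 = j / 5 ^ k) (hi0 : 0 ≤ i) (hi1 : i ≤ 5 ^ k)
    (hj0 : 0 ≤ j) (hj1 : j ≤ 5 ^ k) (hij : j = i + 1 ∨ i = j + 1) :
    v 2 + w 2 ≤ |v 1 - w 1| := by
  have hc : Real.cos (Real.pi * j) = -Real.cos (Real.pi * i) := by
    rcases hij with rfl | rfl
    · push_cast; rw [mul_add, mul_one, Real.cos_add_pi]
    · push_cast; rw [mul_add, mul_one, Real.cos_add_pi, neg_neg]
  have hv' := le_cos_mul_corrugation (p := (v 0, v 2)) hv.1 hvk hi hi0 hi1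
  have hw' := le_cos_mul_corrugation (p := (w 0, w 2)) hw.1 hwk hj hj0 hj1
  rw [hc] at hw'
  have h4 : (1 : ℝ) ≤ 4 ^ k := one_le_pow₀ (by norm_num)
  have hs : ∀ {z : ℝ}, 0 < z → 4 ^ k * z ≤ 1 → z ≤ √z := by
    intro z hz hz1
    refine Real.le_sqrt_of_sq_le ?_
    nlinarith
  have hvs := hs hv.1 hvk
  have hws := hs hw.1 hwk
  have hvp := hv.1
  have hwp := hw.1
  have habs : |Real.cos (Real.pi * i)| = 1 := by
    have := cos_pi_mul_int_sq i
    rw [← abs_mul_abs_self] at this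
    nlinarith [abs_nonneg (Real.cos (Real.pi * i))]
  have key : ∀ x : ℝ, -|x| ≤ Real.cos (Real.pi * i) * x := by
    intro x
    have := neg_abs_le (Real.cos (Real.pi * i) * x)
    rwa [abs_mul, habs, one_mul] at this
  have e1 := key (v 1 - corrugation (v 0, v 2))
  have e2 := key (-(w 1 - corrugation (w 0, w 2)))
  rw [abs_neg] at e2
  have e3 := key (-(v 1 - w 1))
  rw [abs_neg] at e3
  have a1 := abs_sub_corrugation_le hv
  have a2 := abs_sub_corrugation_le hw
  simp only at hv' hw'
  nlinarith

theorem ofReal_le_eVariationOn_of_adjacent {n : ℕ} {γ : ℝ → Euc (n + 3)} (N : ℕ) :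
    ∀ (d k : ℕ), k + d = N → ∀ {a b : ℝ}, a ≤ b → ContinuousOn γ (Icc a b) →
    (∀ τ ∈ Icc a b, γ τ ∈ corrugatedTrough n ∧ 1 < 4 ^ N * γ τ 2 ∧ 4 ^ k * γ τ 2 ≤ 1) →
    ∀ {i j : ℤ}, γ a 0 / γ a 2 = i / 5 ^ k → γ b 0 / γ b 2 = j / 5 ^ k → 0 ≤ i → i ≤ 5 ^ k →
    0 ≤ j → j ≤ 5 ^ k → (j = i + 1 ∨ i = j + 1) →
    ENNReal.ofReal (1 / 8 * (1 / 4) ^ k) ≤ eVariationOn γ (Icc a b) := by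
  intro d
  induction d with
  | zero =>
    intro k hk a b hab _ h
    have := h a (left_mem_Icc.2 hab)
    rw [← hk, add_zero] at this
    linarith [this.2.1, this.2.2]
  | succ d ih =>
    intro k hk a b hab hγ h i j hi hj hi0 hi1 hj0 hj1 hij
    have ham : a ∈ Icc a b := left_mem_Icc.2 hab
    have hbm : b ∈ Icc a b := right_mem_Icc.2 hab
    have hpow : ((1 : ℝ) / 4) ^ k * 4 ^ k = 1 := by rw [← mul_pow]; norm_num
    have hpos : (0 : ℝ) < 4 ^ k := by positivity
    by_cases hend : (1 / 8 * (1 / 4) ^ k ≤ γ a 2 ∧ 1 / 8 * (1 / 4) ^ k ≤ γ b 2)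
    · refine le_trans (ENNReal.ofReal_le_ofReal ?_)
        (ofReal_abs_coord_sub_le_eVariationOn γ 1 ham hbm)
      have := le_abs_sub_of_adjacent (h a ham).1 (h b hbm).1 (h a ham).2.2 (h b hbm).2.2
        hi hj hi0 hi1 hj0 hj1 hij
      linarith [(h b hbm).1.1]
    · obtain ⟨e, he, hel⟩ : ∃ e ∈ Icc a b, γ e 2 < 1 / 8 * (1 / 4) ^ k := by
        by_contra! hcon
        exact hend ⟨hcon a ham, hcon b hbm⟩
      by_cases hhigh : ∃ τ ∈ Icc a b, 1 < 4 ^ (k + 1) * γ τ 2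
      · obtain ⟨τ, hτ, hτ1⟩ := hhigh
        refine le_trans (ENNReal.ofReal_le_ofReal ?_)
          (ofReal_abs_coord_sub_le_eVariationOn γ 2 hτ he)
        refine le_trans ?_ (le_abs_self _)
        rw [pow_succ] at hτ1
        nlinarith
      · push Not at hhigh
        have hu : ContinuousOn (fun τ => γ τ 0 / γ τ 2) (Icc a b) := by
          refine ContinuousOn.div ?_ ?_ fun τ hτ => (h τ hτ).1.1.ne'
          · exact (EuclideanSpace.proj (𝕜 := ℝ) (0 : Fin (n + 3))).continuous.comp_continuousOn hγ
          · exact (EuclideanSpace.proj (𝕜 := ℝ) (2 : Fin (n + 3))).continuous.comp_continuousOn hγ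
        have hstep := mul_le_eVariationOn_of_steps (γ := γ) (u := fun τ => γ τ 0 / γ τ 2)
          (c := ENNReal.ofReal (1 / 8 * (1 / 4) ^ (k + 1))) (α := i / 5 ^ k)
          (δ := (j - i : ℤ) / 5 ^ (k + 1)) 5 hab hu hi
          (by simp only [hj]; push_cast; rw [pow_succ]; field_simp; ring) ?_
        · refine le_trans ?_ hstep
          rw [← ENNReal.ofReal_natCast, ← ENNReal.ofReal_mul (by positivity)]
          refine ENNReal.ofReal_le_ofReal ?_
          rw [pow_succ]
          push_cast
          have : (0 : ℝ) < (1 / 4) ^ k := by positivity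
          linarith
        · intro l hl s t hs hst ht hus hut
          have h5 : (5 : ℤ) ^ (k + 1) = 5 * 5 ^ k := by rw [pow_succ]; ring
          have hP : (0 : ℤ) < 5 ^ k := by positivity
          refine ih (k + 1) (by omega) hst (hγ.mono (Icc_subset_Icc hs ht))
            (fun τ hτ => ?_) (i := 5 * i + l * (j - i)) (j := 5 * i + (l + 1) * (j - i))
            ?_ ?_ ?_ ?_ ?_ ?_ ?_
          · have := Icc_subset_Icc hs ht hτ
            exact ⟨(h τ this).1, (h τ this).2.1, hhigh τ this⟩
          · rw [hus, pow_succ]; push_cast; field_simp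
          · rw [hut, pow_succ]; push_cast; field_simp
          all_goals
            have hij' : j - i = 1 ∨ j - i = -1 := by omega
            rcases hij' with h1 | h1 <;> rw [h1] <;> omega

/-- A path in the trough from slope at most `0` to slope at least `1` is long. -/
theorem ofReal_le_eVariationOn_of_mapsTo_corrugatedTrough {n : ℕ} {γ : ℝ → Euc (n + 3)}
    (hγ : ContinuousOn γ (Icc 0 1)) (hm : MapsTo γ (Icc 0 1) (corrugatedTrough n))
    (h0 : γ 0 0 ≤ 0) (h1 : γ 1 2 ≤ γ 1 0) (hz : γ 0 2 ≤ 7 / 8) :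
    ENNReal.ofReal (1 / 8) ≤ eVariationOn γ (Icc 0 1) := by
  have m0 : (0 : ℝ) ∈ Icc (0 : ℝ) 1 := by simp
  have m1 : (1 : ℝ) ∈ Icc (0 : ℝ) 1 := by simp
  have hc : ∀ i : Fin (n + 3), ContinuousOn (fun τ => γ τ i) (Icc 0 1) := fun i =>
    (EuclideanSpace.proj (𝕜 := ℝ) i).continuous.comp_continuousOn hγ
  by_cases hhigh : ∃ τ ∈ Icc (0 : ℝ) 1, 1 < γ τ 2
  · obtain ⟨τ, hτ, hτ1⟩ := hhigh
    refine le_trans (ENNReal.ofReal_le_ofReal ?_)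
      (ofReal_abs_coord_sub_le_eVariationOn γ 2 hτ m0)
    refine le_trans ?_ (le_abs_self _)
    linarith
  push Not at hhigh
  have hu : ContinuousOn (fun τ => γ τ 0 / γ τ 2) (Icc 0 1) :=
    (hc 0).div (hc 2) fun τ hτ => (hm hτ).1.ne'
  have hu0 : γ 0 0 / γ 0 2 ≤ 0 := div_nonpos_of_nonpos_of_nonneg h0 (hm m0).1.le
  have hu1 : 1 ≤ γ 1 0 / γ 1 2 := (one_le_div (hm m1).1).2 h1
  obtain ⟨a, ha, ha'⟩ := intermediate_value_Icc zero_le_one hu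
    (show (0 : ℝ) ∈ _ from ⟨hu0, zero_le_one.trans hu1⟩)
  have hsub : Icc a 1 ⊆ Icc (0 : ℝ) 1 := Icc_subset_Icc_left ha.1
  obtain ⟨b, hb, hb'⟩ := intermediate_value_Icc ha.2 (hu.mono hsub)
    (show (1 : ℝ) ∈ _ from ⟨ha'.trans_le zero_le_one, hu1⟩)
  obtain ⟨μ, hμ, hmin⟩ := isCompact_Icc.exists_isMinOn ⟨0, m0⟩ (hc 2)
  obtain ⟨N, hN⟩ := pow_unbounded_of_one_lt (1 / γ μ 2) (by norm_num : (1 : ℝ) < 4)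
  rw [div_lt_iff₀ (hm hμ).1] at hN
  have hsub' : Icc a b ⊆ Icc (0 : ℝ) 1 := Icc_subset_Icc ha.1 hb.2
  have := ofReal_le_eVariationOn_of_adjacent (γ := γ) N N 0 (zero_add N) hb.1 (hγ.mono hsub')
    (fun τ hτ => ⟨hm (hsub' hτ), hN.trans_le ?_, ?_⟩) (i := 0) (j := 1) (by simpa using ha')
    (by simpa using hb') le_rfl (by simp) (by simp) (by simp) (by simp)
  · refine le_trans ?_ (this.trans (eVariationOn.mono γ hsub'))
    simp
  · exact mul_le_mul_of_nonneg_left (hmin (hsub' hτ)) (by positivity)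
  · simpa using hhigh τ (hsub' hτ)

theorem intrinsicDist_le_eVariationOn {n : ℕ} {S : Set (Euc n)} {γ : ℝ → Euc n}
    (hγ : ContinuousOn γ (Icc 0 1)) (hm : MapsTo γ (Icc 0 1) S) :
    intrinsicDist S (γ 0) (γ 1) ≤ eVariationOn γ (Icc 0 1) :=
  iInf_le_of_le γ <| iInf_le_of_le hγ <| iInf_le_of_le rfl <| iInf_le_of_le rfl <| iInf_le _ hm

theorem intrinsicDist_le_add {n : ℕ} {S : Set (Euc n)} {γ η : ℝ → Euc n}
    (hγ : ContinuousOn γ (Icc 0 1)) (hη : ContinuousOn η (Icc 0 1)) (hmγ : MapsTo γ (Icc 0 1) S)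
    (hmη : MapsTo η (Icc 0 1) S) (h0 : γ 0 = η 0) :
    intrinsicDist S (γ 1) (η 1) ≤ eVariationOn γ (Icc 0 1) + eVariationOn η (Icc 0 1) := by
  set ζ : ℝ → Euc n := fun t => if t ≤ 1 / 2 then γ (1 - 2 * t) else η (2 * t - 1) with hζ
  have e1 : EqOn ζ (γ ∘ fun t => 1 - 2 * t) (Icc 0 (1 / 2)) := fun t ht => if_pos ht.2
  have e2 : EqOn ζ (η ∘ fun t => 2 * t - 1) (Icc (1 / 2) 1) := by
    intro t ht
    rcases ht.1.eq_or_lt with rfl | h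
    · norm_num [hζ, h0]
    · exact if_neg h.not_ge
  have m1 : MapsTo (fun t : ℝ => 1 - 2 * t) (Icc 0 (1 / 2)) (Icc 0 1) := fun t ht =>
    ⟨by linarith [ht.2], by linarith [ht.1]⟩
  have m2 : MapsTo (fun t : ℝ => 2 * t - 1) (Icc (1 / 2) 1) (Icc 0 1) := fun t ht =>
    ⟨by linarith [ht.1], by linarith [ht.2]⟩
  have hU : Icc (0 : ℝ) (1 / 2) ∪ Icc (1 / 2) 1 = Icc 0 1 :=
    Icc_union_Icc_eq_Icc (by norm_num) (by norm_num)
  have hc : ContinuousOn ζ (Icc 0 1) := by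
    rw [← hU]
    refine ContinuousOn.union_of_isClosed ?_ ?_ isClosed_Icc isClosed_Icc
    · exact (hγ.comp (by fun_prop) m1).congr e1
    · exact (hη.comp (by fun_prop) m2).congr e2
  have hm : MapsTo ζ (Icc 0 1) S := by
    rw [← hU]
    exact ((hmγ.comp m1).congr e1.symm).union_union ((hmη.comp m2).congr e2.symm) |>.mono
      subset_rfl (by simp)
  have := intrinsicDist_le_eVariationOn hc hm
  rw [e1 (by simp), e2 (by norm_num)] at this
  simp only [Function.comp_apply, mul_zero, sub_zero, mul_one] at this
  rw [show (2 : ℝ) - 1 = 1 by norm_num] at this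
  refine this.trans ?_
  have hadd := eVariationOn.Icc_add_Icc ζ (a := 0) (b := 1 / 2) (c := 1) (s := univ)
    (by norm_num) (by norm_num) (mem_univ _)
  simp only [univ_inter] at hadd
  rw [← hadd, eVariationOn.congr e1, eVariationOn.congr e2]
  gcongr
  · exact eVariationOn.comp_le_of_antitoneOn γ _ (fun s _ t _ hst => by linarith) m1
  · exact eVariationOn.comp_le_of_monotoneOn η _ (fun s _ t _ hst => by linarith) m2

theorem rhoY_le_add {n : ℕ} {Y : Set (Euc n)} {γ η : ℝ → Euc n}
    (hγ : ContinuousOn γ (Icc 0 1)) (hη : ContinuousOn η (Icc 0 1))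
    (hmγ : MapsTo γ (Ico 0 1) (mInterior n Y)) (hmη : MapsTo η (Ico 0 1) (mInterior n Y))
    (h0 : γ 0 = η 0) :
    rhoY n Y (γ 1) (η 1) ≤ eVariationOn γ (Icc 0 1) + eVariationOn η (Icc 0 1) := by
  have hev : ∀ᶠ t : ℝ in nhdsWithin 1 (Iio 1), t ∈ Ico (0 : ℝ) 1 := Ico_mem_nhdsLT one_pos
  have htend : ∀ {ζ : ℝ → Euc n}, ContinuousOn ζ (Icc 0 1) → MapsTo ζ (Ico 0 1) (mInterior n Y) →
      Tendsto ζ (nhdsWithin 1 (Iio 1)) (nhdsWithin (ζ 1) (mInterior n Y)) := by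
    intro ζ hζ hm
    refine tendsto_nhdsWithin_iff.2 ⟨?_, hev.mono fun t ht => hm ht⟩
    refine (hζ 1 (by simp)).mono_left ?_
    rw [← nhdsWithin_Ico_eq_nhdsLT (zero_lt_one (α := ℝ))]
    exact nhdsWithin_mono _ Ico_subset_Icc_self
  refine liminf_le_of_frequently_le' ?_
  refine ((htend hγ hmγ).prodMk (htend hη hmη)).frequently (Eventually.frequently ?_)
  filter_upwards [hev] with t ht
  have hmt : MapsTo (fun s : ℝ => s * t) (Icc 0 1) (Ico 0 1) := fun s hs =>
    ⟨mul_nonneg hs.1 ht.1, (mul_le_of_le_one_left ht.1 hs.2).trans_lt ht.2⟩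
  have hmt' := hmt.mono_right Ico_subset_Icc_self
  have hmono : MonotoneOn (fun s : ℝ => s * t) (Icc 0 1) := fun s _ s' _ h =>
    mul_le_mul_of_nonneg_right h ht.1
  have := intrinsicDist_le_add (S := mInterior n Y) (γ := γ ∘ fun s => s * t)
    (η := η ∘ fun s => s * t) (hγ.comp (by fun_prop) hmt') (hη.comp (by fun_prop) hmt')
    (hmγ.comp hmt) (hmη.comp hmt) (by simpa using h0)
  simp only [Function.comp_apply, one_mul] at this
  refine this.trans (add_le_add ?_ ?_)
  · exact eVariationOn.comp_le_of_monotoneOn γ _ hmono hmt'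
  · exact eVariationOn.comp_le_of_monotoneOn η _ hmono hmt'

theorem eVariationOn_Icc_le_of_lipschitzOnWith {n : ℕ} {γ : ℝ → Euc n} {K : NNReal}
    (h : LipschitzOnWith K γ (Icc 0 1)) : eVariationOn γ (Icc 0 1) ≤ K := by
  have h1 := h.comp_eVariationOn_le (f := γ) (g := id) (mapsTo_id _)
  have h2 : eVariationOn (id : ℝ → ℝ) (Icc 0 1) ≤ ENNReal.ofReal (1 - 0) := by
    have := (monotoneOn_id (s := Icc (0 : ℝ) 1)).eVariationOn_eq (a := 0) (b := 1)
      (by simp) (by simp)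
    rw [inter_self] at this
    exact this.le
  refine h1.trans ((mul_le_mul_right h2 _).trans ?_)
  simp

theorem fin_two_ne_one (n : ℕ) : (2 : Fin (n + 3)) ≠ 1 := by
  rw [Ne, Fin.ext_iff, Fin.val_two, Fin.val_one]
  decide

/-- The homeomorphism shearing Euclidean space along the corrugation. -/
def corrugationShear (n : ℕ) : Euc (n + 3) ≃ₜ Euc (n + 3) where
  toFun v := v + corrugation (v 0, v 2) • EuclideanSpace.single 1 1
  invFun v := v - corrugation (v 0, v 2) • EuclideanSpace.single 1 1
  left_inv v := by simp [fin_two_ne_one]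
  right_inv v := by simp [fin_two_ne_one]
  continuous_toFun := by
    have := continuous_corrugation
    fun_prop
  continuous_invFun := by
    have := continuous_corrugation
    fun_prop

theorem corrugationShear_apply {n : ℕ} (v : Euc (n + 3)) : corrugationShear n v =
    v + corrugation (v 0, v 2) • EuclideanSpace.single 1 1 := rfl

theorem corrugationShear_eq_self {n : ℕ} {v : Euc (n + 3)} (h : v 0 ≤ -v 2 ∨ 2 * v 2 ≤ v 0)
    (h2 : 0 ≤ v 2) : corrugationShear n v = v := by
  rw [corrugationShear_apply, corrugation_eq_zero h h2, zero_smul, add_zero]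

theorem norm_sub_single_two_sq {n : ℕ} (v : Euc (n + 3)) :
    ‖v - EuclideanSpace.single 2 1‖ ^ 2 = ‖v‖ ^ 2 - 2 * v 2 + 1 := by
  rw [norm_sub_sq_real, EuclideanSpace.inner_single_right]
  simp

theorem mem_ball_single_two {n : ℕ} {v : Euc (n + 3)} :
    v ∈ ball (EuclideanSpace.single 2 1) 1 ↔ ‖v‖ ^ 2 < 2 * v 2 := by
  rw [mem_ball_iff_norm, ← sq_lt_one_iff₀ (norm_nonneg _), norm_sub_single_two_sq]
  constructor <;> intro <;> linarith

theorem mem_closedBall_single_two {n : ℕ} {v : Euc (n + 3)} :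
    v ∈ closedBall (EuclideanSpace.single 2 1) 1 ↔ ‖v‖ ^ 2 ≤ 2 * v 2 := by
  rw [mem_closedBall_iff_norm, ← sq_le_one_iff₀ (norm_nonneg _), norm_sub_single_two_sq]
  constructor <;> intro <;> linarith

theorem image_corrugationShear_ball_subset (n : ℕ) :
    corrugationShear n '' ball (EuclideanSpace.single 2 1) 1 ⊆ corrugatedTrough n := by
  rintro _ ⟨v, hv, rfl⟩
  rw [mem_ball_single_two] at hv
  have h1 : v 1 ^ 2 ≤ ‖v‖ ^ 2 := by
    rw [← sq_abs (v 1), ← Real.norm_eq_abs]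
    have := PiLp.norm_apply_le v 1
    gcongr
  have h0 : corrugationShear n v 0 = v 0 := by simp [corrugationShear_apply]
  have h2 : corrugationShear n v 2 = v 2 := by simp [corrugationShear_apply, fin_two_ne_one]
  refine ⟨?_, ?_⟩
  · rw [h2]; nlinarith [sq_nonneg ‖v‖]
  · rw [h0, h2]; simp [corrugationShear_apply]; linarith

theorem add_smul_sub_mem_ball {n : ℕ} {c p q : Euc n} (hp : p ∈ ball c 1)
    (hq : q ∈ closedBall c 1) {t : ℝ} (ht : t ∈ Ico (0 : ℝ) 1) : p + t • (q - p) ∈ ball c 1 := by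
  rw [mem_ball_iff_norm] at hp ⊢
  rw [mem_closedBall_iff_norm] at hq
  have h : p + t • (q - p) - c = (1 - t) • (p - c) + t • (q - c) := by module
  rw [h]
  refine (norm_add_le _ _).trans_lt ?_
  rw [norm_smul, norm_smul, Real.norm_of_nonneg ht.1, Real.norm_of_nonneg (by linarith [ht.2])]
  nlinarith [ht.1, ht.2]

/-- The image under the shear of the segment from `p` to `q`. -/
def shearedSegment {n : ℕ} (p q : Euc (n + 3)) (t : ℝ) : Euc (n + 3) :=
  corrugationShear n (p + t • (q - p))

theorem continuous_shearedSegment {n : ℕ} (p q : Euc (n + 3)) :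
    Continuous (shearedSegment p q) :=
  (corrugationShear n).continuous.comp (by fun_prop)

theorem shearedSegment_zero {n : ℕ} (p q : Euc (n + 3)) :
    shearedSegment p q 0 = corrugationShear n p := by simp [shearedSegment]

theorem shearedSegment_one {n : ℕ} (p q : Euc (n + 3)) :
    shearedSegment p q 1 = corrugationShear n q := by simp [shearedSegment]

theorem mapsTo_shearedSegment {n : ℕ} {p q : Euc (n + 3)}
    (hp : p ∈ ball (EuclideanSpace.single 2 1) 1)
    (hq : q ∈ closedBall (EuclideanSpace.single 2 1) 1) :
    MapsTo (shearedSegment p q) (Ico 0 1)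
      (mInterior _ (corrugationShear n '' closedBall (EuclideanSpace.single 2 1) 1)) := by
  rw [mInterior_image_closedBall]
  exact fun t ht => mem_image_of_mem _ (add_smul_sub_mem_ball hp hq ht)

theorem eVariationOn_shearedSegment_zero_le {n : ℕ} {p : Euc (n + 3)}
    (h : p 0 ≤ -p 2 ∨ 2 * p 2 ≤ p 0) (h2 : 0 ≤ p 2) :
    eVariationOn (shearedSegment p 0) (Icc 0 1) ≤ ENNReal.ofReal ‖p‖ := by
  have he : EqOn (shearedSegment p 0) (fun t => (1 - t) • p) (Icc 0 1) := by
    intro t ht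
    have h1t : 0 ≤ 1 - t := by linarith [ht.2]
    have : p + t • ((0 : Euc (n + 3)) - p) = (1 - t) • p := by module
    rw [shearedSegment, this, corrugationShear_eq_self]
    · simp only [PiLp.smul_apply, smul_eq_mul]
      rcases h with h | h
      · left; nlinarith
      · right; nlinarith
    · exact mul_nonneg h1t h2
  rw [eVariationOn.congr he]
  refine (eVariationOn_Icc_le_of_lipschitzOnWith (K := ‖p‖₊) ?_).trans_eq
    (ofReal_norm p).symm
  refine LipschitzOnWith.of_dist_le_mul fun s _ t _ => ?_
  rw [dist_eq_norm, ← sub_smul, norm_smul, Real.dist_eq, Real.norm_eq_abs, coe_nnnorm, mul_comm,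
    abs_sub_comm s t]
  ring_nf
  rfl

theorem eVariationOn_shearedSegment_lt_top {n : ℕ} {p q : Euc (n + 3)} (hp : 0 < p 2)
    (hq : 0 < q 2) : eVariationOn (shearedSegment p q) (Icc 0 1) < ⊤ := by
  have hcd : ContDiffOn ℝ 1 (shearedSegment p q) (Icc 0 1) := by
    intro t ht
    have hpos : 0 < (p + t • (q - p)) 2 := by
      have : (p + t • (q - p)) 2 = (1 - t) * p 2 + t * q 2 := by
        simp; ring
      rw [this]
      rcases ht.1.eq_or_lt with rfl | h
      · simpa using hp
      · have := mul_nonneg (sub_nonneg.2 ht.2) hp.le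
        have := mul_pos h hq
        linarith
    have hs : ContDiff ℝ 1 fun t : ℝ => p + t • (q - p) := by fun_prop
    have hcoord : ∀ i : Fin (n + 3), ContDiff ℝ 1 fun t : ℝ => (p + t • (q - p)) i := fun i =>
      (EuclideanSpace.proj (𝕜 := ℝ) i).contDiff.comp hs
    have hcorr : ContDiffAt ℝ 1
        (fun t : ℝ => corrugation ((p + t • (q - p)) 0, (p + t • (q - p)) 2)) t :=
      ContDiffAt.comp (g := corrugation) t (contDiffAt_corrugation hpos)
        ((hcoord 0).prodMk (hcoord 2)).contDiffAt
    exact (hs.contDiffAt.add (hcorr.smul contDiffAt_const)).contDiffWithinAt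
  obtain ⟨K, hK⟩ := hcd.exists_lipschitzOnWith one_ne_zero (convex_Icc 0 1) isCompact_Icc
  exact (eVariationOn_Icc_le_of_lipschitzOnWith hK).trans_lt ENNReal.coe_lt_top

theorem ofReal_le_rhoY {n : ℕ} {A D : Euc (n + 3)} (hA : A 0 < 0) (hA2 : A 2 < 7 / 8)
    (hD : D 2 < D 0) :
    ENNReal.ofReal (1 / 8) ≤ rhoY (n + 3)
      (corrugationShear n '' closedBall (EuclideanSpace.single 2 1) 1) A D := by
  rw [rhoY, mInterior_image_closedBall]
  have hcoord : ∀ i : Fin (n + 3), Continuous fun v : Euc (n + 3) => v i := fun i =>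
    (EuclideanSpace.proj (𝕜 := ℝ) i).continuous
  have eA : ∀ᶠ v : Euc (n + 3) in nhds A, v 0 < 0 ∧ v 2 < 7 / 8 :=
    ((hcoord 0).continuousAt.eventually_lt_const hA).and
      ((hcoord 2).continuousAt.eventually_lt_const hA2)
  have eD : ∀ᶠ v : Euc (n + 3) in nhds D, v 2 < v 0 :=
    (hcoord 2).continuousAt.eventually_lt (hcoord 0).continuousAt hD
  refine le_liminf_of_le (by isBoundedDefault) ?_
  filter_upwards [prod_mem_prod (nhdsWithin_le_nhds eA) (nhdsWithin_le_nhds eD)] with q hq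
  obtain ⟨⟨h1, h2⟩, h3⟩ := hq
  refine le_iInf fun γ => le_iInf fun hγ => le_iInf fun h0 => le_iInf fun h1' =>
    le_iInf fun hm => ?_
  refine ofReal_le_eVariationOn_of_mapsTo_corrugatedTrough hγ
    (hm.mono_right (image_corrugationShear_ball_subset n)) ?_ ?_ ?_
  · rw [h0]; exact h1.le
  · rw [h1']; exact le_of_lt h3
  · rw [h0]; exact h2.le

/-- A point at height `1 / 100` above the tangency point, displaced sideways by `a`. -/
def nearPoint (n : ℕ) (a : ℝ) : Euc (n + 3) :=
  EuclideanSpace.single 2 (1 / 100) + EuclideanSpace.single 0 a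

theorem fin_two_ne_zero (n : ℕ) : (2 : Fin (n + 3)) ≠ 0 := by
  rw [Ne, Fin.ext_iff, Fin.val_two, Fin.val_zero]
  decide

theorem nearPoint_apply_zero (n : ℕ) (a : ℝ) : nearPoint n a 0 = a := by
  simp [nearPoint, (fin_two_ne_zero n).symm]

theorem nearPoint_apply_two (n : ℕ) (a : ℝ) : nearPoint n a 2 = 1 / 100 := by
  simp [nearPoint, fin_two_ne_zero n]

theorem norm_nearPoint_le (n : ℕ) (a : ℝ) : ‖nearPoint n a‖ ≤ 1 / 100 + |a| := by
  refine (norm_add_le _ _).trans_eq ?_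
  rw [PiLp.norm_single, PiLp.norm_single, Real.norm_eq_abs, Real.norm_eq_abs,
    abs_of_pos (by norm_num : (0 : ℝ) < 1 / 100)]

theorem nearPoint_mem_ball {n : ℕ} {a : ℝ} (ha : |a| ≤ 2 / 100) :
    nearPoint n a ∈ ball (EuclideanSpace.single 2 1) 1 := by
  rw [mem_ball_single_two, nearPoint_apply_two]
  have := norm_nearPoint_le n a
  nlinarith [norm_nonneg (nearPoint n a)]

theorem eVariationOn_shearedSegment_nearPoint_zero_le {n : ℕ} {a : ℝ}
    (ha : a = -(1 / 100) ∨ a = 2 / 100) :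
    eVariationOn (shearedSegment (nearPoint n a) 0) (Icc 0 1) ≤ ENNReal.ofReal (3 / 100) := by
  refine (eVariationOn_shearedSegment_zero_le ?_ ?_).trans (ENNReal.ofReal_le_ofReal ?_)
  · rw [nearPoint_apply_zero, nearPoint_apply_two]
    rcases ha with rfl | rfl
    · left; norm_num
    · right; norm_num
  · rw [nearPoint_apply_two]; norm_num
  · refine (norm_nearPoint_le n a).trans ?_
    rcases ha with rfl | rfl <;> norm_num [abs_of_pos]

theorem eVariationOn_shearedSegment_self {n : ℕ} (p : Euc (n + 3)) :
    eVariationOn (shearedSegment p p) (Icc 0 1) = 0 :=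
  eVariationOn.constant_on (by rintro _ ⟨s, _, rfl⟩ _ ⟨t, _, rfl⟩; simp [shearedSegment])

theorem rhoY_image_closedBall_lt_top {n : ℕ} {x y : Euc (n + 3)}
    (hx : x ∈ corrugationShear n '' closedBall (EuclideanSpace.single 2 1) 1)
    (hy : y ∈ corrugationShear n '' closedBall (EuclideanSpace.single 2 1) 1) :
    rhoY (n + 3) (corrugationShear n '' closedBall (EuclideanSpace.single 2 1) 1) x y < ⊤ := by
  set B := nearPoint n (-(1 / 100)) with hB
  have hBm : B ∈ ball (EuclideanSpace.single 2 1 : Euc (n + 3)) 1 :=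
    nearPoint_mem_ball (by norm_num [abs_of_pos])
  have hfin : ∀ q ∈ closedBall (EuclideanSpace.single 2 1 : Euc (n + 3)) 1,
      eVariationOn (shearedSegment B q) (Icc 0 1) < ⊤ := by
    intro q hq
    rw [mem_closedBall_single_two] at hq
    by_cases h : q = 0
    · rw [h]
      exact (eVariationOn_shearedSegment_nearPoint_zero_le (.inl rfl)).trans_lt
        ENNReal.ofReal_lt_top
    · refine eVariationOn_shearedSegment_lt_top ?_ ?_
      · rw [hB, nearPoint_apply_two]; norm_num
      · have := norm_pos_iff.2 h
        nlinarith
  obtain ⟨p, hp, rfl⟩ := hx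
  obtain ⟨q, hq, rfl⟩ := hy
  have := rhoY_le_add (continuous_shearedSegment B p).continuousOn
    (continuous_shearedSegment B q).continuousOn (mapsTo_shearedSegment hBm hp)
    (mapsTo_shearedSegment hBm hq) (by simp only [shearedSegment_zero])
  rw [shearedSegment_one, shearedSegment_one] at this
  exact this.trans_lt (ENNReal.add_lt_top.2 ⟨hfin p hp, hfin q hq⟩)

/-- Theorem 3.2 (Euclidean case): for every `n ≥ 3` there is a compact connected
`C⁰` `n`-manifold with nonempty boundary `Y ⊆ ℝⁿ` (with open manifold interior)
satisfying condition (i) for which `ρ_Y` is not a metric: the triangle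
inequality fails. -/
theorem exists_rhoY_not_metric
    (n : ℕ) (hn : 3 ≤ n) :
    ∃ Y : Set (Euc n), IsCompact Y ∧ IsConnected Y ∧
      IsC0ManifoldWithBoundary n (by omega) Y ∧
      IsOpen (mInterior n Y) ∧
      (Y \ mInterior n Y).Nonempty ∧
      (∀ x ∈ Y, ∀ y ∈ Y, rhoY n Y x y < ⊤) ∧
      ∃ A ∈ Y, ∃ O ∈ Y, ∃ D ∈ Y,
        rhoY n Y A O + rhoY n Y O D < rhoY n Y A D := by
  obtain ⟨k, rfl⟩ : ∃ k, n = k + 3 := ⟨n - 3, by omega⟩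
  have h0 : (0 : Euc (k + 3)) ∈ closedBall (EuclideanSpace.single 2 1) 1 := by
    rw [mem_closedBall_single_two]; simp
  have hfix0 : corrugationShear k 0 = 0 := corrugationShear_eq_self (by simp) (by simp)
  have hA : nearPoint k (-(1 / 100)) ∈ ball (EuclideanSpace.single 2 1) 1 :=
    nearPoint_mem_ball (by norm_num [abs_of_pos])
  have hD : nearPoint k (2 / 100) ∈ ball (EuclideanSpace.single 2 1) 1 :=
    nearPoint_mem_ball (by norm_num [abs_of_pos])
  have hfixA : corrugationShear k (nearPoint k (-(1 / 100))) = nearPoint k (-(1 / 100)) := by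
    refine corrugationShear_eq_self ?_ ?_ <;>
      norm_num [nearPoint_apply_zero, nearPoint_apply_two]
  have hfixD : corrugationShear k (nearPoint k (2 / 100)) = nearPoint k (2 / 100) := by
    refine corrugationShear_eq_self ?_ ?_ <;>
      norm_num [nearPoint_apply_zero, nearPoint_apply_two]
  refine ⟨corrugationShear k '' closedBall (EuclideanSpace.single 2 1) 1, ?_, ?_,
    isC0ManifoldWithBoundary_image_closedBall _ _ _, ?_, ?_,
    fun x hx y hy => rhoY_image_closedBall_lt_top hx hy,
    _, ⟨_, ball_subset_closedBall hA, hfixA⟩, _, ⟨_, h0, hfix0⟩,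
    _, ⟨_, ball_subset_closedBall hD, hfixD⟩, ?_⟩
  · exact (isCompact_closedBall _ _).image (corrugationShear k).continuous
  · exact ((convex_closedBall _ _).isConnected ⟨_, h0⟩).image _
      (corrugationShear k).continuous.continuousOn
  · rw [mInterior_image_closedBall]
    exact (corrugationShear k).isOpenMap _ isOpen_ball
  · refine ⟨_, mem_image_of_mem _ h0, ?_⟩
    rw [mInterior_image_closedBall, (corrugationShear k).injective.mem_set_image,
      mem_ball_single_two]
    simp
  · set Y := corrugationShear k '' closedBall (EuclideanSpace.single 2 1) 1 with hY
    have hAD : ENNReal.ofReal (1 / 8) ≤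
        rhoY (k + 3) Y (nearPoint k (-(1 / 100))) (nearPoint k (2 / 100)) := by
      refine ofReal_le_rhoY ?_ ?_ ?_ <;>
        norm_num [nearPoint_apply_zero, nearPoint_apply_two]
    have hAO : rhoY (k + 3) Y (nearPoint k (-(1 / 100))) 0 ≤ ENNReal.ofReal (3 / 100) := by
      have := rhoY_le_add (continuous_shearedSegment _ _).continuousOn
        (continuous_shearedSegment _ _).continuousOn
        (mapsTo_shearedSegment hA (ball_subset_closedBall hA)) (mapsTo_shearedSegment hA h0)
        (by simp only [shearedSegment_zero])
      rw [shearedSegment_one, shearedSegment_one, hfixA, hfix0, eVariationOn_shearedSegment_self,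
        zero_add] at this
      exact this.trans (eVariationOn_shearedSegment_nearPoint_zero_le (.inl rfl))
    have hOD : rhoY (k + 3) Y 0 (nearPoint k (2 / 100)) ≤ ENNReal.ofReal (3 / 100) := by
      have := rhoY_le_add (continuous_shearedSegment _ _).continuousOn
        (continuous_shearedSegment _ _).continuousOn
        (mapsTo_shearedSegment hD h0) (mapsTo_shearedSegment hD (ball_subset_closedBall hD))
        (by simp only [shearedSegment_zero])
      rw [shearedSegment_one, shearedSegment_one, hfixD, hfix0, eVariationOn_shearedSegment_self,
        add_zero] at this
      exact this.trans (eVariationOn_shearedSegment_nearPoint_zero_le (.inr rfl))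
    refine (add_le_add hAO hOD).trans_lt (lt_of_lt_of_le ?_ hAD)
    rw [← ENNReal.ofReal_add (by norm_num) (by norm_num)]
    exact (ENNReal.ofReal_lt_ofReal_iff (by norm_num)).2 (by norm_num)
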